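/- For every J ⊆ {1,…,n}, 𝔦_{A_J} = (S^{S_n}_+) : f_J; equivalently, the Solomon–Terao algebra ST(A_J,𝔦) equals S/((S^{S_n}_+) : f_J). -/

import Mathlib

open MvPolynomial

noncomputable section

/-- `varx K n i` is the variable `x_i` for `1 ≤ i ≤ n`, with the convention `x_0 = 0`. -/
def varx (K : Type*) [Field K] (n : ℕ) (i : Fin (n + 1)) : MvPolynomial (Fin n) K :=
  if h : (i : ℕ) = 0 then 0 else X ⟨(i : ℕ) - 1, by have := i.isLt; omega⟩

/-- The linear form `α_{i,j}`: equal to `x_j` when `i = 0` and `x_i − x_j` when `i ≥ 1`. -/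
def alp (K : Type*) [Field K] (n : ℕ) (i j : Fin (n + 1)) : MvPolynomial (Fin n) K :=
  if i = 0 then varx K n j else varx K n i - varx K n j

/-- Defining polynomial `Q(A)` of an arrangement encoded by its index pairs. -/
def QA (K : Type*) [Field K] (n : ℕ) (A : Finset (Fin (n + 1) × Fin (n + 1))) :
    MvPolynomial (Fin n) K :=
  ∏ p ∈ A, alp K n p.1 p.2

/-- The module of derivations `θ` with `q ∣ θ(q)`; for `q = Q(A)` this is `Der(A)`. -/
def DerOf (K : Type*) [Field K] (n : ℕ) (q : MvPolynomial (Fin n) K) :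
    Submodule (MvPolynomial (Fin n) K)
      (Derivation K (MvPolynomial (Fin n) K) (MvPolynomial (Fin n) K)) where
  carrier := {θ | q ∣ θ q}
  add_mem' := by
    intro a b ha hb
    simpa using dvd_add ha hb
  zero_mem' := by simp
  smul_mem' := by
    intro c θ hθ
    simpa [smul_eq_mul] using Dvd.dvd.mul_left hθ c

/-- The `S`-module map `𝔦 : Der(S) → S`, `θ ↦ Σ_k θ(x_k)`, i.e. `∂_k ↦ 1`. -/
def iMap (K : Type*) [Field K] (n : ℕ) :
    Derivation K (MvPolynomial (Fin n) K) (MvPolynomial (Fin n) K)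
      →ₗ[MvPolynomial (Fin n) K] MvPolynomial (Fin n) K where
  toFun θ := ∑ k : Fin n, θ (X k)
  map_add' := by intro a b; simp [Finset.sum_add_distrib]
  map_smul' := by intro c θ; simp [Finset.mul_sum]

/-- The Solomon–Terao ideal `𝔦_A = 𝔦(Der(A))`. -/
def iIdeal (K : Type*) [Field K] (n : ℕ) (A : Finset (Fin (n + 1) × Fin (n + 1))) :
    Ideal (MvPolynomial (Fin n) K) :=
  Submodule.map (iMap K n) (DerOf K n (QA K n A))


def coinvIdeal (K : Type*) [Field K] (n : ℕ) : Ideal (MvPolynomial (Fin n) K) :=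
  Ideal.span {f | f.IsSymmetric ∧ constantCoeff f = 0}

def fJ (K : Type*) [Field K] (n : ℕ) (J : Finset (Fin n)) : MvPolynomial (Fin n) K :=
  ∏ j ∈ J, (X j * ∏ i ∈ Finset.univ.filter fun i => j < i, (X j - X i))

/-- `notInJ J q` says that the variable index represented by `q ∈ {1,…,n}` is not in `J`. -/
def notInJ {n : ℕ} (J : Finset (Fin n)) (q : Fin (n + 1)) : Prop :=
  ∀ j : Fin n, (j : ℕ) + 1 = (q : ℕ) → j ∉ J

instance {n : ℕ} (J : Finset (Fin n)) (q : Fin (n + 1)) : Decidable (notInJ J q) := by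
  unfold notInJ; infer_instance

/-- The arrangement `A_J = {H_{j,i} : j ∉ J, j < i ≤ n} ∪ {H_{0,j} : j ∉ J}`. -/
def AJArr (n : ℕ) (J : Finset (Fin n)) : Finset (Fin (n + 1) × Fin (n + 1)) :=
  Finset.univ.filter fun p : Fin (n + 1) × Fin (n + 1) =>
    p.1 < p.2 ∧ ((p.1 = 0 ∧ notInJ J p.2) ∨ (p.1 ≠ 0 ∧ notInJ J p.1))

section Aux

variable {K : Type*} [Field K] {n : ℕ}

/-- Regular sequences, written in reverse order. -/
def WR {R : Type*} [CommRing R] : List R → Prop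
  | [] => True
  | a :: l => (∀ x, a * x ∈ Ideal.ofList l → x ∈ Ideal.ofList l) ∧ WR l

theorem ofList_perm {R : Type*} [CommRing R] {l l' : List R} (h : l.Perm l') :
    Ideal.ofList l = Ideal.ofList l' := by
  unfold Ideal.ofList
  congr 1
  ext x
  exact h.mem_iff

def PosHom (a : MvPolynomial (Fin n) K) : Prop := ∃ d, 0 < d ∧ a.IsHomogeneous d

theorem hc_mem {l : List (MvPolynomial (Fin n) K)} (hl : ∀ a ∈ l, PosHom a)
    {x : MvPolynomial (Fin n) K} (hx : x ∈ Ideal.ofList l) (d : ℕ) :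
    homogeneousComponent d x ∈ Ideal.ofList l := by
  let _ := MvPolynomial.gradedAlgebra (σ := Fin n) (R := K)
  have h : (Ideal.ofList l).IsHomogeneous (homogeneousSubmodule (Fin n) K) := by
    apply Ideal.homogeneous_span
    intro a ha
    obtain ⟨d, -, hd⟩ := hl a ha
    exact ⟨d, hd⟩
  have := h d hx
  rwa [← MvPolynomial.decomposition.decompose'_apply]

theorem krull_hom {l : List (MvPolynomial (Fin n) K)} (hl : ∀ a ∈ l, PosHom a)
    {a : MvPolynomial (Fin n) K} (ha : PosHom a) {x : MvPolynomial (Fin n) K}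
    (h : ∀ k : ℕ, ∃ y, x - a ^ k * y ∈ Ideal.ofList l) : x ∈ Ideal.ofList l := by
  have ham : a ∈ idealOfVars (Fin n) K := by
    obtain ⟨d, hd, hh⟩ := ha
    rw [← pow_one (idealOfVars (Fin n) K), mem_pow_idealOfVars_iff]
    intro m hm
    have := hh (mem_support_iff.1 hm)
    rw [Finsupp.degree_eq_weight_one]
    exact le_trans (Nat.succ_le_of_lt hd) (le_of_eq this.symm)
  obtain ⟨y, hy⟩ := h (x.totalDegree + 1)
  rw [← sum_homogeneousComponent x]
  refine Ideal.sum_mem _ fun i hi => ?_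
  have h1 := hc_mem hl hy i
  have h2 : homogeneousComponent i (a ^ (x.totalDegree + 1) * y) = 0 := by
    have h3 : a ^ (x.totalDegree + 1) * y ∈ idealOfVars (Fin n) K ^ (x.totalDegree + 1) :=
      Ideal.mul_mem_right _ _ (Ideal.pow_mem_pow ham _)
    rw [mem_pow_idealOfVars_iff'] at h3
    ext m
    rw [coeff_homogeneousComponent]
    split_ifs with hm
    · rw [h3 m (by rw [hm]; exact Finset.mem_range.1 hi)]; simp
    · simp
  rwa [map_sub, h2, sub_zero] at h1

theorem mem_ofList_cons {R : Type*} [CommRing R] {a x : R} {l : List R} :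
    x ∈ Ideal.ofList (a :: l) ↔ ∃ y, x - a * y ∈ Ideal.ofList l := by
  rw [Ideal.ofList_cons, Submodule.mem_sup]
  constructor
  · rintro ⟨u, hu, v, hv, rfl⟩
    obtain ⟨y, rfl⟩ := Ideal.mem_span_singleton'.1 hu
    exact ⟨y, by convert hv using 1; ring⟩
  · rintro ⟨y, hy⟩
    exact ⟨a * y, Ideal.mem_span_singleton'.2 ⟨y, mul_comm _ _⟩, _, hy, by ring⟩

theorem WR_swap {l : List (MvPolynomial (Fin n) K)} {a b : MvPolynomial (Fin n) K}
    (hl : ∀ a ∈ l, PosHom a) (hb : PosHom b)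
    (h : WR (a :: b :: l)) : WR (b :: a :: l) := by
  obtain ⟨h1, h2, h3⟩ := h
  have key : ∀ x, a * x ∈ Ideal.ofList l → x ∈ Ideal.ofList l := by
    intro x hx
    apply krull_hom hl hb
    suffices ∀ k : ℕ, ∃ y, x - b ^ k * y ∈ Ideal.ofList l ∧ a * y ∈ Ideal.ofList l from
      fun k => (this k).imp fun _ h => h.1
    intro k
    induction k with
    | zero => exact ⟨x, by simp, hx⟩
    | succ k ih =>
      obtain ⟨y, hy, hay⟩ := ih
      obtain ⟨z, hz⟩ := mem_ofList_cons.1 (h1 y (mem_ofList_cons.2 ⟨0, by simpa using hay⟩))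
      refine ⟨z, ?_, ?_⟩
      · have := add_mem hy (Ideal.mul_mem_left _ (b ^ k) hz)
        convert this using 1; ring
      · apply h2
        have := sub_mem hay (Ideal.mul_mem_left _ a hz)
        convert this using 1; ring
  refine ⟨?_, key, h3⟩
  intro x hx
  obtain ⟨y, hy⟩ := mem_ofList_cons.1 hx
  have h4 : a * y ∈ Ideal.ofList (b :: l) := by
    refine mem_ofList_cons.2 ⟨x, ?_⟩
    convert neg_mem hy using 1; ring
  obtain ⟨z, hz⟩ := mem_ofList_cons.1 (h1 y h4)
  refine mem_ofList_cons.2 ⟨z, h2 _ ?_⟩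
  have := add_mem hy (Ideal.mul_mem_left _ a hz)
  convert this using 1; ring

theorem WR_perm {l l' : List (MvPolynomial (Fin n) K)} (hp : l.Perm l')
    (hl : ∀ a ∈ l, PosHom a) (h : WR l) : WR l' := by
  induction hp with
  | nil => trivial
  | cons a hp ih =>
    refine ⟨?_, ih (fun a ha => hl a (List.mem_cons_of_mem _ ha)) h.2⟩
    rw [← ofList_perm hp]
    exact h.1
  | swap a b l => exact WR_swap (fun c hc => hl c (by simp [hc])) (hl _ (by simp)) h
  | trans h1 h2 ih1 ih2 => exact ih2 (fun a ha => hl a (h1.mem_iff.2 ha)) (ih1 hl h)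

theorem WR_congr {R : Type*} [CommRing R] {l : List R} {a b : R}
    (hab : a - b ∈ Ideal.ofList l) (h : WR (a :: l)) : WR (b :: l) := by
  refine ⟨fun x hx => h.1 x ?_, h.2⟩
  have := add_mem hx (Ideal.mul_mem_right x _ hab)
  convert this using 1; ring

theorem ofList_congr {R : Type*} [CommRing R] {l : List R} {a b : R}
    (hab : a - b ∈ Ideal.ofList l) : Ideal.ofList (a :: l) = Ideal.ofList (b :: l) := by
  ext x
  rw [mem_ofList_cons, mem_ofList_cons]
  refine exists_congr fun y => ?_
  have h := Ideal.mul_mem_right y _ hab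
  constructor <;> intro h'
  · convert add_mem h' h using 1; ring
  · convert sub_mem h' h using 1; ring

theorem WR_X (l : List (Fin n)) (h : l.Nodup) :
    WR (l.map (X : Fin n → MvPolynomial (Fin n) K)) := by
  induction l with
  | nil => trivial
  | cons i l ih =>
    rw [List.nodup_cons] at h
    refine ⟨?_, ih h.2⟩
    intro x hx
    have e : Ideal.ofList (l.map (X : Fin n → MvPolynomial (Fin n) K)) =
        Ideal.span (X '' {j | j ∈ l}) := by
      unfold Ideal.ofList
      congr 1
      ext x; simp
    rw [e, mem_ideal_span_X_image] at hx ⊢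
    intro m hm
    obtain ⟨j, hj, hmj⟩ := hx (m + Finsupp.single i 1) (by
      rw [mem_support_iff] at *
      rwa [mul_comm, coeff_mul_X])
    refine ⟨j, hj, ?_⟩
    have : i ≠ j := by rintro rfl; exact h.1 hj
    simpa [this] using hmj

/-- power sums -/
def sumEv (P : Polynomial (MvPolynomial (Fin n) K)) : MvPolynomial (Fin n) K :=
  ∑ i, P.eval (X i)

theorem sumEv_mem {I : Ideal (MvPolynomial (Fin n) K)} {P : Polynomial (MvPolynomial (Fin n) K)}
    (h : ∀ k, P.coeff k = 0 ∨ psum (Fin n) K k ∈ I) : sumEv P ∈ I := by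
  have : sumEv P = ∑ k ∈ Finset.range (P.natDegree + 1), P.coeff k * psum (Fin n) K k := by
    unfold sumEv psum
    simp_rw [Polynomial.eval_eq_sum_range, Finset.mul_sum]
    rw [Finset.sum_comm]
  rw [this]
  refine Ideal.sum_mem _ fun k _ => ?_
  rcases h k with h | h
  · simp [h]
  · exact Ideal.mul_mem_left _ _ h

theorem sumEv_monic {I : Ideal (MvPolynomial (Fin n) K)} {P : Polynomial (MvPolynomial (Fin n) K)}
    {d : ℕ} (hm : P.Monic) (hd : P.natDegree = d) (h0 : P.coeff 0 = 0)
    (h : ∀ k, k + 1 < d → psum (Fin n) K (k + 1) ∈ I) : sumEv P - psum (Fin n) K d ∈ I := by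
  have : sumEv P - psum (Fin n) K d = sumEv (P - Polynomial.X ^ d) := by
    simp [sumEv, psum]
  rw [this]
  apply sumEv_mem
  intro k
  rcases lt_trichotomy k d with hk | rfl | hk
  · cases k with
    | zero => left; simp [h0, Polynomial.coeff_X_pow]; omega
    | succ k => right; exact h k hk
  · left; subst hd; simp [hm.coeff_natDegree]
  · left; rw [Polynomial.coeff_sub, Polynomial.coeff_eq_zero_of_natDegree_lt (by omega),
      Polynomial.coeff_X_pow, if_neg (by omega), sub_zero]

theorem posHom_X (i : Fin n) : PosHom (X i : MvPolynomial (Fin n) K) :=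
  ⟨1, one_pos, isHomogeneous_X _ _⟩

theorem posHom_psum (k : ℕ) : PosHom (psum (Fin n) K (k + 1)) :=
  ⟨k + 1, by omega, by
    apply IsHomogeneous.sum
    intro i _
    simpa using (isHomogeneous_X K i).pow (k + 1)⟩

def psList (K : Type*) [Field K] (n m : ℕ) : List (MvPolynomial (Fin n) K) :=
  (List.range m).map fun k => psum (Fin n) K (k + 1)

theorem psList_perm (m : ℕ) :
    (psList K n (m + 1)).Perm (psum (Fin n) K (m + 1) :: psList K n m) := by
  unfold psList
  rw [List.range_succ, List.map_append]
  exact List.perm_append_comm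

theorem WR_prod {R : Type*} [CommRing R] {ι : Type*} (T : Finset ι) (f : ι → R) (l : List R)
    (hl : WR l) (h : ∀ i ∈ T, WR (f i :: l)) : WR ((∏ i ∈ T, f i) :: l) := by
  classical
  induction T using Finset.induction_on with
  | empty => exact ⟨fun x hx => by simpa using hx, hl⟩
  | insert a T ha ih =>
    refine ⟨fun x hx => ?_, hl⟩
    rw [Finset.prod_insert ha, mul_assoc] at hx
    exact (ih fun i hi => h i (Finset.mem_insert_of_mem hi)).1 _
      ((h a (Finset.mem_insert_self _ _)).1 _ hx)

theorem WR_psum_T [CharZero K] (t : ℕ) (T : Finset (Fin n)) (hT : T.card = t) :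
    WR (psList K n t ++ (Tᶜ).toList.map X) := by
  classical
  induction t generalizing T with
  | zero => simpa [psList] using WR_X (K := K) _ (Finset.nodup_toList (Tᶜ))
  | succ t ih =>
    set M := psList K n t ++ (Tᶜ).toList.map (X : Fin n → MvPolynomial (Fin n) K) with hM
    have hMpos : ∀ a ∈ M, PosHom a := by
      intro a ha
      simp only [hM, psList, List.mem_append, List.mem_map] at ha
      rcases ha with ⟨k, -, rfl⟩ | ⟨k, -, rfl⟩
      · exact posHom_psum k
      · exact posHom_X k
    have h1 : ∀ i ∈ T, WR ((X i : MvPolynomial (Fin n) K) :: M) := by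
      intro i hi
      have h := ih (T.erase i) (by rw [Finset.card_erase_of_mem hi, hT]; rfl)
      have hp : (psList K n t ++ ((T.erase i)ᶜ).toList.map (X : Fin n → MvPolynomial (Fin n) K)).Perm
          (X i :: M) := by
        have e : (T.erase i)ᶜ = insert i Tᶜ := by ext; simp
        rw [e]
        have := (Finset.toList_insert (a := i) (s := Tᶜ) (by simpa using hi)).map
          (X : Fin n → MvPolynomial (Fin n) K)
        exact (this.append_left _).trans List.perm_middle
      refine WR_perm hp ?_ h
      intro a ha
      rw [hp.mem_iff, List.mem_cons] at ha
      rcases ha with rfl | ha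
      · exact posHom_X i
      · exact hMpos a ha
    have hMw : WR M := by
      obtain ⟨i, hi⟩ := Finset.card_pos.1 (by omega : 0 < T.card)
      exact (h1 i hi).2
    have h2 := WR_prod T (X : Fin n → MvPolynomial (Fin n) K) M hMw h1
    let G : Polynomial (MvPolynomial (Fin n) K) := ∏ i ∈ T, (Polynomial.X - Polynomial.C (X i))
    have hG : G.Monic := Polynomial.monic_prod_X_sub_C _ _
    have hGd : G.natDegree = t + 1 := by
      rw [← hT]; exact Polynomial.natDegree_finsetProd_X_sub_C_eq_card _ _
    have hG0 : G.eval 0 = (-1) ^ (t + 1) * ∏ i ∈ T, X i := by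
      simp [G, Polynomial.eval_prod, Finset.prod_neg, hT]
    have hGm : (G - Polynomial.C (G.eval 0)).Monic := by
      apply hG.sub_of_left
      apply lt_of_le_of_lt Polynomial.degree_C_le
      rw [Polynomial.degree_eq_natDegree hG.ne_zero, hGd]
      exact_mod_cast Nat.succ_pos t
    have h3 := sumEv_monic (I := Ideal.ofList M) (d := t + 1) hGm
      (by rw [Polynomial.natDegree_sub_C, hGd]) (by simp [Polynomial.coeff_zero_eq_eval_zero])
      (fun k hk => Ideal.subset_span (by
        simp only [hM, psList, Set.mem_ofPred_eq, List.mem_append, List.mem_map, List.mem_range]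
        exact Or.inl ⟨k, by omega, rfl⟩))
    have h4 : sumEv (G - Polynomial.C (G.eval 0)) + ((t + 1 : ℕ) : MvPolynomial (Fin n) K) * G.eval 0
        ∈ Ideal.ofList M := by
      have e : sumEv (G - Polynomial.C (G.eval 0)) + ((t + 1 : ℕ) : MvPolynomial (Fin n) K) * G.eval 0
          = ∑ i ∈ Tᶜ, (G.eval (X i) - G.eval 0) := by
        unfold sumEv
        rw [← Finset.sum_add_sum_compl T]
        have : ∀ i ∈ T, (G - Polynomial.C (G.eval 0)).eval (X i) = - G.eval 0 := by
          intro i hi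
          have : G.eval (X i) = 0 := by
            simp only [G, Polynomial.eval_prod]
            exact Finset.prod_eq_zero hi (by simp)
          simp [this]
        rw [Finset.sum_congr rfl this]
        simp [hT]
      rw [e]
      refine Ideal.sum_mem _ fun i hi => ?_
      have hd := Polynomial.sub_dvd_eval_sub (X i) 0 G
      rw [sub_zero] at hd
      refine Ideal.mem_of_dvd _ hd (Ideal.subset_span ?_)
      simp only [hM, Set.mem_ofPred_eq, List.mem_append, List.mem_map]
      exact Or.inr ⟨i, by simpa using hi, rfl⟩
    have h5 : WR (psum (Fin n) K (t + 1) :: M) := by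
      refine ⟨fun x hx => h2.1 x ?_, hMw⟩
      have h6 : ((t + 1 : ℕ) : MvPolynomial (Fin n) K) * G.eval 0 + psum (Fin n) K (t + 1) ∈
          Ideal.ofList M := by
        convert sub_mem h4 h3 using 1; ring
      have h7 : (((t + 1 : ℕ) : MvPolynomial (Fin n) K) * G.eval 0) * x ∈ Ideal.ofList M := by
        convert sub_mem (Ideal.mul_mem_right x _ h6) hx using 1; ring
      have hc : C (((t + 1 : ℕ) : K)⁻¹) * ((t + 1 : ℕ) : MvPolynomial (Fin n) K) = 1 := by
        rw [← map_natCast (C : K →+* MvPolynomial (Fin n) K), ← C_mul, inv_mul_cancel₀, C_1]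
        exact Nat.cast_ne_zero.2 (Nat.succ_ne_zero t)
      have hs : ((-1 : MvPolynomial (Fin n) K) ^ (t + 1)) * (-1) ^ (t + 1) = 1 := by
        rw [← mul_pow]; simp
      have := Ideal.mul_mem_left _ (C (((t + 1 : ℕ) : K)⁻¹) * (-1) ^ (t + 1)) h7
      rw [hG0] at this
      convert this using 1
      linear_combination (-(∏ i ∈ T, X i) * x) * hs
        - (-1) ^ (t + 1) * (-1) ^ (t + 1) * (∏ i ∈ T, X i) * x * hc
    have hp : (psum (Fin n) K (t + 1) :: M).Perm
        (psList K n (t + 1) ++ (Tᶜ).toList.map (X : Fin n → MvPolynomial (Fin n) K)) :=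
      ((psList_perm (K := K) (n := n) t).symm.append_right _)
    refine WR_perm hp ?_ h5
    intro a ha
    rcases List.mem_cons.1 ha with rfl | ha
    · exact posHom_psum t
    · exact hMpos a ha

theorem WR_psum [CharZero K] : WR (psList K n n) := by
  simpa using WR_psum_T (K := K) (n := n) n Finset.univ (by simp)

theorem coinv_eq [CharZero K] : coinvIdeal K n = Ideal.ofList (psList K n n) := by
  apply le_antisymm
  · rw [coinvIdeal, Ideal.span_le]
    rintro f ⟨hf, hf0⟩
    have hps : ∀ k, k + 1 ≤ n → psum (Fin n) K (k + 1) ∈ Ideal.ofList (psList K n n) := by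
      intro k hk
      apply Ideal.subset_span
      simp only [psList, Set.mem_ofPred_eq, List.mem_map, List.mem_range]
      exact ⟨k, by omega, rfl⟩
    have hes : ∀ i : Fin n, esymm (Fin n) K (i + 1) ∈ Ideal.ofList (psList K n n) := by
      intro i
      have h := mul_esymm_eq_sum (Fin n) K (i + 1)
      have h1 : (((i : ℕ) + 1 : ℕ) : MvPolynomial (Fin n) K) * esymm (Fin n) K (i + 1) ∈
          Ideal.ofList (psList K n n) := by
        rw [h]
        refine Ideal.mul_mem_left _ _ (Ideal.sum_mem _ fun a ha => Ideal.mul_mem_left _ _ ?_)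
        have ha1 := Finset.HasAntidiagonal.mem_antidiagonal.1 (Finset.mem_filter.1 ha).1
        have ha2 := (Finset.mem_filter.1 ha).2
        obtain ⟨k, hk⟩ : ∃ k, a.2 = k + 1 := ⟨a.2 - 1, by omega⟩
        rw [hk]
        exact hps k (by have := i.2; omega)
      have hc : C ((((i : ℕ) + 1 : ℕ) : K)⁻¹) * (((i : ℕ) + 1 : ℕ) : MvPolynomial (Fin n) K) = 1 := by
        rw [← map_natCast (C : K →+* MvPolynomial (Fin n) K), ← C_mul, inv_mul_cancel₀, C_1]
        exact Nat.cast_ne_zero.2 (Nat.succ_ne_zero i)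
      have := Ideal.mul_mem_left _ (C ((((i : ℕ) + 1 : ℕ) : K)⁻¹)) h1
      rwa [← mul_assoc, hc, one_mul] at this
    obtain ⟨p, hp⟩ := esymmAlgHom_surjective (σ := Fin n) K (n := n) (by simp) ⟨f, hf⟩
    have hp' : aeval (fun i : Fin n ↦ esymm (Fin n) K (i + 1)) p = f := by
      rw [← esymmAlgHom_apply, hp]
    have hq : ∀ q : MvPolynomial (Fin n) K,
        aeval (fun i : Fin n ↦ esymm (Fin n) K (i + 1)) q - C (constantCoeff q) ∈
          Ideal.ofList (psList K n n) := by
      intro q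
      induction q using MvPolynomial.induction_on with
      | C a => simp
      | add p q hp hq =>
        convert add_mem hp hq using 1
        simp; ring
      | mul_X p i hp =>
        simp only [map_mul, aeval_X, constantCoeff_X, mul_zero, C_0, sub_zero]
        exact Ideal.mul_mem_left _ _ (hes i)
    have h1 := hq p
    rw [hp'] at h1
    have h2 : Ideal.ofList (psList K n n) ≤ RingHom.ker (constantCoeff : MvPolynomial (Fin n) K →+* K) := by
      rw [Ideal.ofList, Ideal.span_le]
      intro a ha
      simp only [psList, Set.mem_ofPred_eq, List.mem_map, List.mem_range] at ha
      obtain ⟨k, -, rfl⟩ := ha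
      simp [psum]
    have h3 := h2 h1
    rw [RingHom.mem_ker, map_sub, hf0, constantCoeff_C, zero_sub, neg_eq_zero] at h3
    simpa [h3] using h1
  · rw [Ideal.ofList, Ideal.span_le]
    intro a ha
    simp only [psList, Set.mem_ofPred_eq, List.mem_map, List.mem_range] at ha
    obtain ⟨k, -, rfl⟩ := ha
    exact Ideal.subset_span ⟨psum_isSymmetric _ _ _, by simp [psum]⟩

def qq (K : Type*) [Field K] {n : ℕ} (J : Finset (Fin n)) (j : Fin n) : MvPolynomial (Fin n) K :=
  ∏ i ∈ Finset.univ.filter (fun i => i ∉ J ∧ i < j), (X j - X i)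

def gg (K : Type*) [Field K] {n : ℕ} (j : Fin n) : MvPolynomial (Fin n) K :=
  X j * ∏ i ∈ Finset.univ.filter fun i => j < i, (X j - X i)

theorem fJ_eq (J : Finset (Fin n)) : fJ K n J = ∏ j ∈ J, gg K j := rfl

def LJ (K : Type*) [Field K] {n : ℕ} (J : Finset (Fin n)) : List (MvPolynomial (Fin n) K) :=
  psList K n (n - J.card) ++ J.toList.map (qq K J)

theorem psum_mem_LM {J : Finset (Fin n)} {m k : ℕ} (hk : k < m) :
    psum (Fin n) K (k + 1) ∈ Ideal.ofList (psList K n m ++ J.toList.map (qq K J)) :=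
  Ideal.subset_span (by
    simp only [psList, Set.mem_ofPred_eq, List.mem_append, List.mem_map, List.mem_range]
    exact Or.inl ⟨k, by omega, rfl⟩)

theorem qq_mem_LM {J : Finset (Fin n)} {m : ℕ} {k : Fin n} (hk : k ∈ J) :
    qq K J k ∈ Ideal.ofList (psList K n m ++ J.toList.map (qq K J)) :=
  Ideal.subset_span (by
    simp only [Set.mem_ofPred_eq, List.mem_append, List.mem_map]
    exact Or.inr ⟨k, by simpa using hk, rfl⟩)

theorem key_congr (J : Finset (Fin n)) (j : Fin n) (hJ : ∀ k ∈ J, k < j) (m : ℕ)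
    (hm : J.card + (m + 1) = n) :
    psum (Fin n) K (m + 1) - gg K j * qq K J j ∈
      Ideal.ofList (psList K n m ++ J.toList.map (qq K J)) := by
  classical
  have hj : j ∉ J := fun h => lt_irrefl _ (hJ j h)
  let T : Finset (Fin n) := (insert j J)ᶜ
  have hT : T.card = m := by
    simp only [T, Finset.card_compl, Finset.card_insert_of_notMem hj, Fintype.card_fin]
    omega
  let G : Polynomial (MvPolynomial (Fin n) K) :=
    Polynomial.X * ∏ l ∈ T, (Polynomial.X - Polynomial.C (X l))
  have hP : (∏ l ∈ T, (Polynomial.X - Polynomial.C (X l : MvPolynomial (Fin n) K))).Monic :=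
    Polynomial.monic_prod_X_sub_C _ _
  have hG : G.Monic := Polynomial.monic_X.mul hP
  have hGd : G.natDegree = m + 1 := by
    rw [Polynomial.Monic.natDegree_mul Polynomial.monic_X hP,
      Polynomial.natDegree_finsetProd_X_sub_C_eq_card, hT, Polynomial.natDegree_X, add_comm]
  have h1 := sumEv_monic (I := Ideal.ofList (psList K n m ++ J.toList.map (qq K J)))
    hG hGd (by simp [G]) (fun k hk => psum_mem_LM (by omega))
  have hGe : ∀ i, G.eval (X i) = X i * ∏ l ∈ T, (X i - X l) := by
    intro i; simp [G, Polynomial.eval_prod]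
  have hGj : G.eval (X j) = gg K j * qq K J j := by
    rw [hGe, gg, qq, mul_assoc, ← Finset.prod_union]
    · congr 2
      ext i
      simp only [T, Finset.mem_compl, Finset.mem_insert, Finset.mem_union, Finset.mem_filter,
        Finset.mem_univ, true_and, not_or]
      constructor
      · rintro ⟨h1, h2⟩
        rcases lt_or_gt_of_ne h1 with h | h
        · exact Or.inr ⟨h2, h⟩
        · exact Or.inl h
      · rintro (h | ⟨h2, h⟩)
        · exact ⟨h.ne', fun hi => absurd (hJ i hi) (not_lt.2 h.le)⟩
        · exact ⟨h.ne, h2⟩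
    · rw [Finset.disjoint_left]
      intro i hi hi'
      simp only [Finset.mem_filter, Finset.mem_univ, true_and] at hi hi'
      exact absurd hi (not_lt.2 hi'.2.le)
  have h2 : sumEv G - gg K j * qq K J j ∈
      Ideal.ofList (psList K n m ++ J.toList.map (qq K J)) := by
    unfold sumEv
    rw [← Finset.add_sum_erase _ _ (Finset.mem_univ j), hGj, add_sub_cancel_left]
    refine Ideal.sum_mem _ fun i hi => ?_
    have hij : i ≠ j := (Finset.mem_erase.1 hi).1
    rw [hGe]
    by_cases hiJ : i ∈ J
    · refine Ideal.mem_of_dvd _ (Dvd.dvd.mul_left ?_ _) (qq_mem_LM hiJ)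
      unfold qq
      apply Finset.prod_dvd_prod_of_subset
      intro l hl
      simp only [Finset.mem_filter, Finset.mem_univ, true_and] at hl
      simp only [T, Finset.mem_compl, Finset.mem_insert, not_or]
      exact ⟨(hl.2.trans (hJ i hiJ)).ne, hl.1⟩
    · rw [Finset.prod_eq_zero (i := i) (by simp [T, hij, hiJ]) (sub_self _), mul_zero]
      exact zero_mem _
  convert sub_mem h2 h1 using 1; ring

theorem qq_insert (J : Finset (Fin n)) (j k : Fin n) (hk : k ≤ j) :
    qq K (insert j J) k = qq K J k := by
  unfold qq
  congr 1
  ext i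
  simp only [Finset.mem_filter, Finset.mem_univ, true_and, Finset.mem_insert, not_or]
  constructor
  · rintro ⟨⟨-, h⟩, h'⟩; exact ⟨h, h'⟩
  · rintro ⟨h, h'⟩; exact ⟨⟨(h'.trans_le hk).ne, h⟩, h'⟩

theorem posHom_qq (J : Finset (Fin n)) (j : Fin n) (hJ : ∀ k ∈ J, (k : ℕ) ≠ 0) (hj : (j : ℕ) ≠ 0) :
    PosHom (qq K J j) := by
  refine ⟨_, ?_, IsHomogeneous.prod _ _ (fun _ => 1) fun i _ =>
    (isHomogeneous_X K j).sub (isHomogeneous_X K i)⟩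
  rw [Finset.sum_const, smul_eq_mul, mul_one, Finset.card_pos]
  refine ⟨⟨0, by have := j.2; omega⟩, ?_⟩
  simp only [Finset.mem_filter, Finset.mem_univ, true_and]
  exact ⟨fun h => hJ _ h rfl, by rw [Fin.lt_def]; simp; omega⟩

theorem posHom_LM (J : Finset (Fin n)) (m : ℕ) (hJ : ∀ k ∈ J, (k : ℕ) ≠ 0) :
    ∀ a ∈ psList K n m ++ J.toList.map (qq K J), PosHom a := by
  intro a ha
  simp only [psList, List.mem_append, List.mem_map] at ha
  rcases ha with ⟨k, -, rfl⟩ | ⟨k, hk, rfl⟩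
  · exact posHom_psum k
  · exact posHom_qq J k hJ (hJ k (by simpa using hk))

theorem chain [CharZero K] (J : Finset (Fin n)) (hJ : ∀ k ∈ J, (k : ℕ) ≠ 0) :
    WR (LJ K J) ∧ ∀ x, x ∈ Ideal.ofList (LJ K J) ↔ x * fJ K n J ∈ coinvIdeal K n := by
  classical
  induction J using Finset.induction_on_max with
  | empty => simpa [LJ, fJ, coinv_eq] using WR_psum
  | insert j J hlt ih =>
    obtain ⟨h1, h2⟩ := ih fun k hk => hJ k (Finset.mem_insert_of_mem hk)
    have hj : j ∉ J := fun h => lt_irrefl _ (hlt j h)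
    have hJ' : ∀ k ∈ J, (k : ℕ) ≠ 0 := fun k hk => hJ k (Finset.mem_insert_of_mem hk)
    have hc : (insert j J).card ≤ n := by simpa using Finset.card_le_univ (insert j J)
    rw [Finset.card_insert_of_notMem hj] at hc
    obtain ⟨m, hm⟩ : ∃ m, J.card + (m + 1) = n := ⟨n - J.card - 1, by omega⟩
    set M := psList K n m ++ J.toList.map (qq K J) with hM
    have p1 : (LJ K J).Perm (psum (Fin n) K (m + 1) :: M) := by
      unfold LJ
      rw [show n - J.card = m + 1 by omega]
      exact (psList_perm m).append_right _
    have p2 : (LJ K (insert j J)).Perm (qq K J j :: M) := by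
      unfold LJ
      rw [Finset.card_insert_of_notMem hj, show n - (J.card + 1) = m by omega]
      have := (Finset.toList_insert hj).map (qq K (insert j J))
      refine (this.append_left _).trans ?_
      rw [List.map_cons, qq_insert J j j le_rfl]
      have e : J.toList.map (qq K (insert j J)) = J.toList.map (qq K J) := by
        apply List.map_congr_left
        intro k hk
        exact qq_insert J j k (hlt k (by simpa using hk)).le
      rw [e]
      exact List.perm_middle
    have hk := key_congr (K := K) J j hlt m hm
    have w1 : WR (gg K j * qq K J j :: M) :=
      WR_congr hk (WR_perm p1 (by
        intro a ha
        exact posHom_LM J _ hJ' a ha) h1)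
    have i1 : Ideal.ofList (LJ K J) = Ideal.ofList (gg K j * qq K J j :: M) := by
      rw [ofList_perm p1, ofList_congr hk]
    have w2 : WR (qq K J j :: M) := by
      refine ⟨fun x hx => w1.1 x ?_, w1.2⟩
      rw [mul_assoc]
      exact Ideal.mul_mem_left _ _ hx
    constructor
    · refine WR_perm p2.symm ?_ w2
      intro a ha
      rw [← p2.mem_iff] at ha
      exact posHom_LM _ _ hJ a ha
    · intro x
      rw [ofList_perm p2, fJ_eq, Finset.prod_insert hj, ← mul_assoc, ← fJ_eq, ← h2, i1,
        mem_ofList_cons, mem_ofList_cons]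
      refine exists_congr fun y => ⟨fun h => ?_, fun h => w1.1 _ ?_⟩
      · convert Ideal.mul_mem_left _ (gg K j) h using 1; ring
      · convert Ideal.mul_mem_left _ (qq K J j) h using 1; ring

theorem fJ_mem_coinv [CharZero K] (J : Finset (Fin n)) (k : Fin n) (hk : k ∈ J) (hk0 : (k : ℕ) = 0) :
    fJ K n J ∈ coinvIdeal K n := by
  have hn : 0 < n := by have := k.2; omega
  rw [fJ_eq]
  refine Ideal.mem_of_dvd _ (Finset.dvd_prod_of_mem _ hk) ?_
  obtain ⟨m, hm⟩ : ∃ m, n = m + 1 := ⟨n - 1, by omega⟩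
  have h := key_congr (K := K) ∅ k (by simp) m (by simp [hm])
  have hq : qq K ∅ k = 1 := by
    unfold qq
    rw [Finset.filter_false_of_mem, Finset.prod_empty]
    rintro i - ⟨-, hi⟩
    rw [Fin.lt_def] at hi
    omega
  rw [hq, mul_one] at h
  have h1 : Ideal.ofList (psList K n m ++ (∅ : Finset (Fin n)).toList.map (qq K ∅)) ≤ coinvIdeal K n := by
    rw [coinv_eq]
    apply Ideal.span_mono
    intro a ha
    simp [psList] at ha ⊢
    obtain ⟨k, hk, rfl⟩ := ha
    exact ⟨k, by omega, rfl⟩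
  have h2 : psum (Fin n) K (m + 1) ∈ coinvIdeal K n :=
    Ideal.subset_span ⟨psum_isSymmetric _ _ _, by simp [psum]⟩
  convert sub_mem h2 (h1 h) using 1; ring

theorem colon_eq [CharZero K] (J : Finset (Fin n)) :
    Ideal.ofList (LJ K J) = (coinvIdeal K n).colon (Ideal.span {fJ K n J}) := by
  have hcol : ∀ x, x ∈ (coinvIdeal K n).colon (Ideal.span {fJ K n J}) ↔
      x * fJ K n J ∈ coinvIdeal K n := by
    intro x
    rw [Submodule.mem_colon]
    constructor
    · intro h
      exact h _ (Ideal.subset_span rfl)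
    · intro h s hs
      obtain ⟨c, rfl⟩ := Ideal.mem_span_singleton'.1 hs
      convert Ideal.mul_mem_left _ c h using 1
      simp only [smul_eq_mul]; ring
  ext x
  rw [hcol]
  by_cases hJ : ∀ k ∈ J, (k : ℕ) ≠ 0
  · exact (chain J hJ).2 x
  · push Not at hJ
    obtain ⟨k, hk, hk0⟩ := hJ
    refine ⟨fun _ => Ideal.mul_mem_left _ _ (fJ_mem_coinv J k hk hk0), fun _ => ?_⟩
    have hq : qq K J k = 1 := by
      unfold qq
      rw [Finset.filter_false_of_mem, Finset.prod_empty]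
      rintro i - ⟨-, hi⟩
      rw [Fin.lt_def] at hi
      omega
    have := qq_mem_LM (K := K) (m := n - J.card) hk
    rw [hq] at this
    exact (Ideal.eq_top_iff_one _).2 this ▸ Submodule.mem_top

def vdd (K : Type*) [Field K] (n : ℕ) (a b : Fin (n + 1)) : MvPolynomial (Fin n) K :=
  varx K n a - varx K n b

theorem varx_zero : varx K n 0 = 0 := by simp [varx]

theorem varx_succ (k : Fin n) : varx K n k.succ = X k := by simp [varx]

theorem varx_injective : Function.Injective (varx K n) := by
  intro a b h
  induction a using Fin.cases with
  | zero =>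
    induction b using Fin.cases with
    | zero => rfl
    | succ b => rw [varx_zero, varx_succ] at h; exact absurd h.symm (X_ne_zero b)
  | succ a =>
    induction b using Fin.cases with
    | zero => rw [varx_zero, varx_succ] at h; exact absurd h (X_ne_zero a)
    | succ b => rw [varx_succ, varx_succ] at h; rw [X_injective h]

theorem alp_eq (a b : Fin (n + 1)) : alp K n a b = vdd K n a b ∨ alp K n a b = - vdd K n a b := by
  unfold alp vdd
  split_ifs with h
  · right; rw [h, varx_zero]; ring
  · left; rfl

theorem vdd_comm (a b : Fin (n + 1)) : vdd K n a b = - vdd K n b a := by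
  unfold vdd; ring

/-- the substitution sending `varx b` to `varx a` -/
def sbst (K : Type*) [Field K] (n : ℕ) (a b : Fin (n + 1)) :
    MvPolynomial (Fin n) K →ₐ[K] MvPolynomial (Fin n) K :=
  aeval fun k => if k.succ = b then varx K n a else X k

theorem sbst_varx (a b : Fin (n + 1)) (hb : b ≠ 0) (k : Fin (n + 1)) :
    sbst K n a b (varx K n k) = varx K n (if k = b then a else k) := by
  induction k using Fin.cases with
  | zero => rw [varx_zero, map_zero, if_neg hb.symm, varx_zero]
  | succ k =>
    rw [varx_succ, sbst, aeval_X]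
    split_ifs
    · rfl
    · rw [varx_succ]

theorem dvd_sub_sbst (a b : Fin (n + 1)) (f : MvPolynomial (Fin n) K) :
    vdd K n a b ∣ f - sbst K n a b f := by
  induction f using MvPolynomial.induction_on with
  | C c => simp [sbst]
  | add p q hp hq =>
    convert dvd_add hp hq using 1
    rw [map_add]; ring
  | mul_X p k hp =>
    have h : vdd K n a b ∣ X k - sbst K n a b (X k) := by
      rw [sbst, aeval_X]
      split_ifs with h
      · rw [← varx_succ (K := K) k, h, ← neg_sub]
        exact (dvd_neg.2 dvd_rfl)
      · simp
    have := dvd_add (Dvd.dvd.mul_right hp (X k)) (Dvd.dvd.mul_left h (sbst K n a b p))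
    convert this using 1
    rw [map_mul]; ring

theorem sbst_vdd (a b : Fin (n + 1)) (hb : b ≠ 0) : sbst K n a b (vdd K n a b) = 0 := by
  rw [vdd, map_sub, sbst_varx a b hb, sbst_varx a b hb]
  simp

theorem vdd_dvd_iff (a b : Fin (n + 1)) (hb : b ≠ 0) (f : MvPolynomial (Fin n) K) :
    vdd K n a b ∣ f ↔ sbst K n a b f = 0 := by
  constructor
  · rintro ⟨c, rfl⟩
    rw [map_mul, sbst_vdd a b hb, zero_mul]
  · intro h
    simpa [h] using dvd_sub_sbst a b f

theorem vdd_prime (a b : Fin (n + 1)) (h : a ≠ b) : Prime (vdd K n a b) := by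
  wlog hb : b ≠ 0 generalizing a b
  · push Not at hb
    rw [vdd_comm]
    exact (this b a h.symm (by rw [← hb]; exact h)).neg
  refine ⟨?_, ?_, ?_⟩
  · exact sub_ne_zero.2 fun e => h (varx_injective e)
  · intro hu
    have := hu.map (sbst K n a b)
    rw [sbst_vdd a b hb] at this
    exact not_isUnit_zero this
  · intro f g hfg
    rw [vdd_dvd_iff a b hb, map_mul, mul_eq_zero] at hfg
    rwa [vdd_dvd_iff a b hb, vdd_dvd_iff a b hb]

theorem vdd_dvd_vdd (a b c d : Fin (n + 1)) (hcd : c ≠ d)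
    (h : vdd K n a b ∣ vdd K n c d) : (c = a ∧ d = b) ∨ (c = b ∧ d = a) := by
  wlog hb : b ≠ 0 generalizing a b
  · push Not at hb
    by_cases ha : a = 0
    · rw [ha, hb, vdd, sub_self, zero_dvd_iff, vdd, sub_eq_zero] at h
      exact absurd (varx_injective h) hcd
    · exact (this b a (by rwa [vdd_comm, neg_dvd]) ha).symm
  rw [vdd_dvd_iff a b hb, vdd, map_sub, sbst_varx a b hb, sbst_varx a b hb, sub_eq_zero] at h
  have := varx_injective h
  grind

theorem prod_vdd_dvd (j : Fin (n + 1)) (s : Finset (Fin (n + 1))) (hj : j ∉ s)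
    (f : MvPolynomial (Fin n) K) (h : ∀ a ∈ s, vdd K n j a ∣ f) : ∏ a ∈ s, vdd K n j a ∣ f := by
  classical
  induction s using Finset.induction_on with
  | empty => simp
  | insert a s ha ih =>
    obtain ⟨g, hg⟩ := ih (fun h => hj (Finset.mem_insert_of_mem h))
      fun b hb => h b (Finset.mem_insert_of_mem hb)
    have hja : j ≠ a := by rintro rfl; exact hj (Finset.mem_insert_self _ _)
    have hp := vdd_prime (K := K) j a hja
    have h1 := h a (Finset.mem_insert_self _ _)
    rw [hg] at h1
    rcases hp.dvd_or_dvd h1 with h2 | h2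
    · exfalso
      obtain ⟨b, hb, hb'⟩ := (Prime.dvd_finsetProd_iff hp _).1 h2
      have hjb : j ≠ b := by rintro rfl; exact hj (Finset.mem_insert_of_mem hb)
      rcases vdd_dvd_vdd _ _ _ _ hjb hb' with ⟨-, rfl⟩ | ⟨rfl, -⟩
      · exact ha hb
      · exact hja rfl
    · rw [Finset.prod_insert ha, hg, mul_comm]
      exact mul_dvd_mul_left _ h2

theorem interp (u : Fin (n + 1) → MvPolynomial (Fin n) K) (s : Finset (Fin (n + 1)))
    (h : ∀ a ∈ s, ∀ b ∈ s, vdd K n a b ∣ u a - u b) :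
    ∃ P : Polynomial (MvPolynomial (Fin n) K), (∀ a ∈ s, P.eval (varx K n a) = u a) ∧
      ∀ k, s.card ≤ k → P.coeff k = 0 := by
  classical
  induction s using Finset.induction_on with
  | empty => exact ⟨0, by simp, by simp⟩
  | insert j s hj ih =>
    obtain ⟨P, hP, hd⟩ := ih fun a ha b hb =>
      h a (Finset.mem_insert_of_mem ha) b (Finset.mem_insert_of_mem hb)
    obtain ⟨c, hc⟩ := prod_vdd_dvd j s hj (u j - P.eval (varx K n j)) (by
      intro a ha
      have h1 := h j (Finset.mem_insert_self _ _) a (Finset.mem_insert_of_mem ha)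
      have h2 : vdd K n j a ∣ _ := Polynomial.sub_dvd_eval_sub (varx K n j) (varx K n a) P
      rw [hP a ha] at h2
      convert dvd_sub h1 h2 using 1; ring)
    let G : Polynomial (MvPolynomial (Fin n) K) :=
      ∏ a ∈ s, (Polynomial.X - Polynomial.C (varx K n a))
    refine ⟨P + Polynomial.C c * G, ?_, ?_⟩
    · intro a ha
      rcases Finset.mem_insert.1 ha with rfl | ha
      · simp only [Polynomial.eval_add, Polynomial.eval_mul, Polynomial.eval_C, G,
          Polynomial.eval_prod, Polynomial.eval_sub, Polynomial.eval_X]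
        simp only [vdd] at hc
        linear_combination -hc
      · have : G.eval (varx K n a) = 0 := by
          simp only [G, Polynomial.eval_prod]
          exact Finset.prod_eq_zero ha (by simp)
        simp [this, hP a ha]
    · intro k hk
      rw [Finset.card_insert_of_notMem hj] at hk
      have : G.natDegree = s.card := Polynomial.natDegree_finsetProd_X_sub_C_eq_card _ _
      rw [Polynomial.coeff_add, hd k (by omega), Polynomial.coeff_C_mul,
        Polynomial.coeff_eq_zero_of_natDegree_lt (p := G) (by omega)]
      simp

theorem dvd_alp_iff (a b : Fin (n + 1))
    (θ : Derivation K (MvPolynomial (Fin n) K) (MvPolynomial (Fin n) K)) :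
    alp K n a b ∣ θ (alp K n a b) ↔
      vdd K n a b ∣ θ (varx K n a) - θ (varx K n b) := by
  rw [← map_sub]
  change _ ↔ vdd K n a b ∣ θ (vdd K n a b)
  rcases alp_eq (K := K) a b with h | h
  · rw [h]
  · rw [h, map_neg, neg_dvd, dvd_neg]

theorem mem_DerOf_iff (A : Finset (Fin (n + 1) × Fin (n + 1))) (hA : ∀ p ∈ A, p.1 < p.2)
    (θ : Derivation K (MvPolynomial (Fin n) K) (MvPolynomial (Fin n) K)) :
    θ ∈ DerOf K n (QA K n A) ↔
      ∀ p ∈ A, vdd K n p.1 p.2 ∣ θ (varx K n p.1) - θ (varx K n p.2) := by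
  classical
  change QA K n A ∣ θ (QA K n A) ↔ _
  simp_rw [← dvd_alp_iff]
  constructor
  · intro h p hp
    have hpr : Prime (alp K n p.1 p.2) := by
      rcases alp_eq (K := K) p.1 p.2 with e | e
      · rw [e]; exact vdd_prime _ _ (hA p hp).ne
      · rw [e]; exact (vdd_prime _ _ (hA p hp).ne).neg
    have e : QA K n A = alp K n p.1 p.2 * ∏ q ∈ A.erase p, alp K n q.1 q.2 :=
      (Finset.mul_prod_erase A (fun q => alp K n q.1 q.2) hp).symm
    have h1 : alp K n p.1 p.2 ∣ θ (QA K n A) := (Dvd.intro _ e.symm).trans h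
    rw [e, Derivation.leibniz, smul_eq_mul, smul_eq_mul] at h1
    have h2 := (dvd_add_right (dvd_mul_right _ _)).1 h1
    rcases hpr.dvd_or_dvd h2 with h3 | h3
    · exfalso
      obtain ⟨q, hq, hq'⟩ := (Prime.dvd_finsetProd_iff hpr _).1 h3
      have hqA := Finset.mem_of_mem_erase hq
      have h4 : vdd K n p.1 p.2 ∣ vdd K n q.1 q.2 := by
        rcases alp_eq (K := K) p.1 p.2 with e | e <;>
        rcases alp_eq (K := K) q.1 q.2 with e' | e' <;>
        simpa [e, e'] using hq'
      rcases vdd_dvd_vdd _ _ _ _ (hA q hqA).ne h4 with ⟨e1, e2⟩ | ⟨e1, e2⟩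
      · exact (Finset.mem_erase.1 hq).1 (Prod.ext e1 e2)
      · have a1 := hA q hqA
        have a2 := hA p hp
        rw [e1, e2] at a1
        exact lt_asymm a1 a2
    · exact h3
  · intro h
    clear hA
    unfold QA
    induction A using Finset.induction_on with
    | empty => simp
    | insert p A hp ih =>
      have h1 := ih fun q hq => h q (Finset.mem_insert_of_mem hq)
      have h2 := h p (Finset.mem_insert_self _ _)
      rw [Finset.prod_insert hp, Derivation.leibniz, smul_eq_mul, smul_eq_mul]
      apply dvd_add
      · exact mul_dvd_mul_left _ h1
      · rw [mul_comm]; exact mul_dvd_mul_left _ h2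

theorem notInJ_succ (J : Finset (Fin n)) (i : Fin n) : notInJ J i.succ ↔ i ∉ J := by
  unfold notInJ
  constructor
  · intro h; exact h i (by simp)
  · intro h j hj
    have : j = i := by ext; simpa using hj
    rwa [this]

theorem mem_AJ_zero (J : Finset (Fin n)) (i : Fin n) : ((0 : Fin (n + 1)), i.succ) ∈ AJArr n J ↔ i ∉ J := by
  simp [AJArr, notInJ_succ]

theorem mem_AJ_succ (J : Finset (Fin n)) (i l : Fin n) :
    (i.succ, l.succ) ∈ AJArr n J ↔ i < l ∧ i ∉ J := by
  simp [AJArr, notInJ_succ]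

theorem AJ_lt (J : Finset (Fin n)) : ∀ p ∈ AJArr n J, p.1 < p.2 := by
  intro p hp
  simp only [AJArr, Finset.mem_filter] at hp
  exact hp.2.1

theorem iMap_apply (θ : Derivation K (MvPolynomial (Fin n) K) (MvPolynomial (Fin n) K)) :
    iMap K n θ = ∑ k : Fin n, θ (X k) := rfl

theorem iIdeal_le (J : Finset (Fin n)) : iIdeal K n (AJArr n J) ≤ Ideal.ofList (LJ K J) := by
  classical
  rintro _ ⟨θ, hθ, rfl⟩
  have hθ' := (mem_DerOf_iff _ (AJ_lt J) θ).1 hθ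
  let s : Finset (Fin (n + 1)) := insert 0 ((Jᶜ).map (Fin.succEmb n))
  have hs : ∀ a ∈ s, a = 0 ∨ ∃ i, i ∉ J ∧ a = i.succ := by
    intro a ha
    rcases Finset.mem_insert.1 ha with h | h
    · exact Or.inl h
    · right
      obtain ⟨i, hi, rfl⟩ := Finset.mem_map.1 h
      exact ⟨i, by simpa using hi, rfl⟩
  have hcard : s.card = n - J.card + 1 := by
    rw [Finset.card_insert_of_notMem (by simp [Fin.succ_ne_zero]), Finset.card_map,
      Finset.card_compl, Fintype.card_fin]
  obtain ⟨P, hP, hd⟩ := interp (fun a => θ (varx K n a)) s (by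
    intro a ha b hb
    wlog hab : a < b generalizing a b
    · rcases eq_or_lt_of_le (not_lt.1 hab) with rfl | h
      · simp
      · have := this b hb a ha h
        rw [vdd_comm, neg_dvd, ← neg_sub, dvd_neg]
        exact this
    rcases hs b hb with rfl | ⟨l, hl, rfl⟩
    · exact absurd hab (by simp)
    rcases hs a ha with rfl | ⟨i, hi, rfl⟩
    · have h1 := (mem_AJ_zero J l).2 hl
      exact hθ' (0, l.succ) h1
    · have h0 : i < l := Fin.succ_lt_succ_iff.1 hab
      have h1 := (mem_AJ_succ J i l).2 ⟨h0, hi⟩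
      exact hθ' (i.succ, l.succ) h1)
  have e : iMap K n θ = sumEv P + ∑ k, (θ (X k) - P.eval (X k)) := by
    rw [iMap_apply, Finset.sum_sub_distrib]
    simp [sumEv]
  rw [e]
  refine add_mem (sumEv_mem fun k => ?_) (Ideal.sum_mem _ fun k _ => ?_)
  · cases k with
    | zero =>
      left
      have := hP 0 (Finset.mem_insert_self _ _)
      rw [varx_zero, map_zero] at this
      rw [Polynomial.coeff_zero_eq_eval_zero, this]
    | succ k =>
      by_cases hk : k < n - J.card
      · right; exact psum_mem_LM hk
      · left; exact hd _ (by omega)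
  · by_cases hk : k ∈ J
    · refine Ideal.mem_of_dvd _ ?_ (qq_mem_LM hk)
      have h1 : qq K J k = ∏ a ∈ (Finset.univ.filter fun i => i ∉ J ∧ i < k).map (Fin.succEmb n),
          vdd K n k.succ a := by
        rw [Finset.prod_map]
        simp [vdd, varx_succ, qq]
      rw [h1]
      apply prod_vdd_dvd
      · simp
      · intro a ha
        obtain ⟨i, hi, rfl⟩ := Finset.mem_map.1 ha
        simp only [Finset.mem_filter, Finset.mem_univ, true_and] at hi
        have h2 := hθ' _ ((mem_AJ_succ J i k).2 ⟨hi.2, hi.1⟩)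
        have h3 : vdd K n i.succ k.succ ∣ _ :=
          Polynomial.sub_dvd_eval_sub (varx K n i.succ) (varx K n k.succ) P
        rw [hP i.succ (by simp [s, hi.1])] at h3
        change vdd K n k.succ i.succ ∣ _
        rw [vdd_comm, neg_dvd]
        have h4 := dvd_sub h3 h2
        simp only [varx_succ] at h4 ⊢
        convert h4 using 1; ring
    · have := hP k.succ (by simp [s, hk])
      rw [varx_succ] at this
      rw [this, sub_self]
      exact zero_mem _

theorem le_iIdeal (J : Finset (Fin n)) : Ideal.ofList (LJ K J) ≤ iIdeal K n (AJArr n J) := by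
  classical
  rw [Ideal.ofList, Ideal.span_le]
  intro a ha
  simp only [LJ, psList, Set.mem_ofPred_eq, List.mem_append, List.mem_map] at ha
  rcases ha with ⟨k, -, rfl⟩ | ⟨j, hj, rfl⟩
  · refine ⟨mkDerivation K fun i => X i ^ (k + 1), (mem_DerOf_iff _ (AJ_lt J) _).2 ?_, ?_⟩
    · intro p _
      have : ∀ c, mkDerivation K (fun i => (X i : MvPolynomial (Fin n) K) ^ (k + 1)) (varx K n c) =
          varx K n c ^ (k + 1) := by
        intro c
        induction c using Fin.cases with
        | zero => simp [varx_zero]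
        | succ c => rw [varx_succ, mkDerivation_X]
      rw [this, this]
      exact sub_dvd_pow_sub_pow _ _ _
    · rw [iMap_apply]
      simp [psum, mkDerivation_X]
  · have hj' : j ∈ J := by simpa using hj
    refine ⟨mkDerivation K fun i => if i = j then qq K J j else 0,
      (mem_DerOf_iff _ (AJ_lt J) _).2 ?_, ?_⟩
    · rintro ⟨a, b⟩ hp
      induction b using Fin.cases with
      | zero => exact absurd (AJ_lt J _ hp) (by simp)
      | succ l =>
      induction a using Fin.cases with
      | zero =>
        rw [mem_AJ_zero] at hp
        have hl : l ≠ j := by rintro rfl; exact hp hj'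
        simp [varx_zero, varx_succ, mkDerivation_X, hl]
      | succ i =>
        rw [mem_AJ_succ] at hp
        have hi : i ≠ j := by rintro rfl; exact hp.2 hj'
        simp only [varx_succ, mkDerivation_X, vdd, if_neg hi]
        split_ifs with hl
        · subst hl
          rw [zero_sub, dvd_neg, ← neg_sub, neg_dvd]
          unfold qq
          exact Finset.dvd_prod_of_mem (fun i => (X l - X i : MvPolynomial (Fin n) K))
            (by simp [hp.1, hp.2])
        · simp
    · rw [iMap_apply]
      simp [mkDerivation_X]

end Aux

theorem statement15 (K : Type*) [Field K] [CharZero K] (n : ℕ) (hn : 0 < n)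
    (J : Finset (Fin n)) :
    iIdeal K n (AJArr n J) = (coinvIdeal K n).colon (Ideal.span {fJ K n J}) := by
  rw [← colon_eq]
  exact le_antisymm (iIdeal_le J) (le_iIdeal J)
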